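/- arXiv:2206.05632 — 4 statements merged into one kernel-verified Lean document; each statement's English description precedes it below -/
import Mathlib

section
/- Let α, β be real numbers with |β| > |α| > 0. Then the function f : ℝ → ℝ defined by f(x) = cosh(αx)/cosh(βx) is positive definite; that is, for every n and all real numbers x₁, …, xₙ, the n×n matrix with (i,j) entry f(xᵢ − xⱼ) is positive semidefinite. (Lemma 2.1(i)) -/
open Filter Topology in
/-- Euler's infinite product for the hyperbolic sine. -/
theorem Real.tendsto_euler_sinh_prod (t : ℝ) :
    Tendsto (fun n : ℕ => Real.pi * t * ∏ j ∈ Finset.range n, (1 + t ^ 2 / ((j : ℝ) + 1) ^ 2))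
      atTop (𝓝 (Real.sinh (Real.pi * t))) := by
  have h := ((Complex.continuous_im.tendsto _).comp
    (Complex.tendsto_euler_sin_prod (t * Complex.I)))
  have hsin : (Complex.sin (Real.pi * (t * Complex.I))).im = Real.sinh (Real.pi * t) := by
    rw [← mul_assoc, Complex.sin_mul_I, ← Complex.ofReal_mul, ← Complex.ofReal_sinh,
      Complex.im_ofReal_mul, Complex.I_im, mul_one]
  rw [hsin] at h
  refine h.congr fun n => ?_
  have hprod : (∏ j ∈ Finset.range n, ((1 : ℂ) - (t * Complex.I) ^ 2 / ((j : ℂ) + 1) ^ 2)) =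
      ((∏ j ∈ Finset.range n, (1 + t ^ 2 / ((j : ℝ) + 1) ^ 2) : ℝ) : ℂ) := by
    push_cast
    refine Finset.prod_congr rfl fun j _ => ?_
    rw [mul_pow, Complex.I_sq]
    ring
  have hfactor (p : ℝ) : (Real.pi : ℂ) * (t * Complex.I) * (p : ℂ) =
      ((Real.pi * t * p : ℝ) : ℂ) * Complex.I := by
    push_cast
    ring
  rw [Function.comp_apply, hprod, hfactor, Complex.im_ofReal_mul, Complex.I_im, mul_one]

open Filter Topology in
/-- The infinite product for the hyperbolic cosine. -/
theorem Real.tendsto_euler_cosh_prod (t : ℝ) :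
    Tendsto (fun n : ℕ => ∏ j ∈ Finset.range n, (1 + (2 * t) ^ 2 / (2 * (j : ℝ) + 1) ^ 2))
      atTop (𝓝 (Real.cosh (Real.pi * t))) := by
  rcases eq_or_ne t 0 with rfl | ht
  · simp
  have hsplit (n : ℕ) :
      ∏ j ∈ Finset.range (2 * n), (1 + (2 * t) ^ 2 / ((j : ℝ) + 1) ^ 2) =
        (∏ j ∈ Finset.range n, (1 + (2 * t) ^ 2 / (2 * (j : ℝ) + 1) ^ 2)) *
          ∏ j ∈ Finset.range n, (1 + t ^ 2 / ((j : ℝ) + 1) ^ 2) := by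
    induction n with
    | zero => simp
    | succ n ih =>
      rw [mul_add_one, Finset.prod_range_succ, Finset.prod_range_succ, ih,
        Finset.prod_range_succ, Finset.prod_range_succ]
      have heven : (2 * t) ^ 2 / (((2 * n + 1 : ℕ) : ℝ) + 1) ^ 2 = t ^ 2 / ((n : ℝ) + 1) ^ 2 := by
        have : ((n : ℝ) + 1) ≠ 0 := by positivity
        push_cast
        rw [show (2 * (n : ℝ) + 1 + 1) = 2 * (n + 1) by ring]
        field_simp
      rw [heven]
      push_cast
      ring
  have hpi := Real.pi_ne_zero
  have hsinh : Real.sinh (Real.pi * t) ≠ 0 := by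
    rw [Ne, Real.sinh_eq_zero]
    exact mul_ne_zero hpi ht
  have hdouble := (Real.tendsto_euler_sinh_prod (2 * t)).comp
    (tendsto_id.const_mul_atTop' (zero_lt_two (α := ℕ)))
  have hquot := (hdouble.div (Real.tendsto_euler_sinh_prod t) hsinh).div_const 2
  have hlim : Real.sinh (Real.pi * (2 * t)) / Real.sinh (Real.pi * t) / 2 =
      Real.cosh (Real.pi * t) := by
    rw [show Real.pi * (2 * t) = 2 * (Real.pi * t) by ring, Real.sinh_two_mul]
    field_simp
  rw [hlim] at hquot
  refine hquot.congr fun n => ?_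
  have hpos : ∏ j ∈ Finset.range n, (1 + t ^ 2 / ((j : ℝ) + 1) ^ 2) ≠ 0 :=
    Finset.prod_ne_zero_iff.mpr fun j _ => by positivity
  simp only [Pi.div_apply, Function.comp_apply, id_eq, hsplit]
  field_simp

open Filter Topology in
/-- An entrywise limit of positive semidefinite real matrices is positive semidefinite. -/
theorem Matrix.PosSemidef.of_tendsto {ι : Type*} [Fintype ι] {M : ℕ → Matrix ι ι ℝ}
    {A : Matrix ι ι ℝ} (hM : ∀ k, (M k).PosSemidef)
    (h : ∀ i j, Tendsto (fun k => M k i j) atTop (𝓝 (A i j))) : A.PosSemidef := by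
  refine .of_dotProduct_mulVec_nonneg ?_ fun v => ?_
  · refine Matrix.IsHermitian.ext fun i j => ?_
    exact tendsto_nhds_unique (star_trivial (A j i) ▸ h j i)
      ((h i j).congr fun k => ((hM k).isHermitian.apply i j).symm)
  · refine ge_of_tendsto' (x := atTop) (f := fun k => star v ⬝ᵥ (M k).mulVec v) ?_
      fun k => (hM k).dotProduct_mulVec_nonneg v
    simp only [dotProduct, Matrix.mulVec]
    exact tendsto_finsetSum _ fun i _ => tendsto_const_nhds.mul
      (tendsto_finsetSum _ fun j _ => (h i j).mul tendsto_const_nhds)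

open MeasureTheory in
/-- `s ↦ 1 / (1 + s ^ 2)` is the cosine transform of the exponential density. -/
theorem integrableOn_and_integral_exp_neg_mul_cos (s : ℝ) :
    IntegrableOn (fun t : ℝ => Real.exp (-t) * Real.cos (s * t)) (Set.Ioi 0) ∧
      ∫ t in Set.Ioi (0 : ℝ), Real.exp (-t) * Real.cos (s * t) = 1 / (1 + s ^ 2) := by
  have ha : ((-1 + s * Complex.I : ℂ)).re < 0 := by simp
  have hre (t : ℝ) : (Complex.exp ((-1 + s * Complex.I) * t)).re =
      Real.exp (-t) * Real.cos (s * t) := by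
    rw [Complex.exp_re]
    simp
  have hint := integrableOn_exp_mul_complex_Ioi ha 0
  refine ⟨by simpa only [IntegrableOn, RCLike.re_eq_complex_re, hre] using! hint.re, ?_⟩
  have h := integral_re hint
  simp only [RCLike.re_eq_complex_re, hre] at h
  rw [h, integral_exp_mul_complex_Ioi ha]
  simp [Complex.div_re, Complex.normSq_apply, pow_two]

open MeasureTheory in
theorem posSemidef_one_div_one_add_sq {ι : Type*} [Fintype ι] (x : ι → ℝ) :
    (Matrix.of fun i j => 1 / (1 + (x i - x j) ^ 2)).PosSemidef := by
  refine .of_dotProduct_mulVec_nonneg ?_ fun v => ?_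
  · ext i j
    simp only [Matrix.conjTranspose_apply, Matrix.of_apply, star_trivial]
    rw [sub_sq_comm]
  have hint (i j : ι) := (integrableOn_and_integral_exp_neg_mul_cos (x i - x j)).1.const_mul
    (v i * v j)
  have hform : star v ⬝ᵥ (Matrix.of fun i j => 1 / (1 + (x i - x j) ^ 2)).mulVec v =
      ∫ t in Set.Ioi (0 : ℝ), ∑ i, ∑ j,
        v i * v j * (Real.exp (-t) * Real.cos ((x i - x j) * t)) := by
    rw [integral_finsetSum _ fun i _ => integrable_finsetSum _ fun j _ => hint i j]
    simp only [dotProduct, Matrix.mulVec, Matrix.of_apply, star_trivial, Finset.mul_sum]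
    refine Finset.sum_congr rfl fun i _ => ?_
    rw [integral_finsetSum _ fun j _ => hint i j]
    refine Finset.sum_congr rfl fun j _ => ?_
    rw [integral_const_mul, (integrableOn_and_integral_exp_neg_mul_cos _).2]
    ring
  rw [hform]
  refine integral_nonneg fun t => ?_
  have hsq : ∑ i, ∑ j, v i * v j * (Real.exp (-t) * Real.cos ((x i - x j) * t)) =
      Real.exp (-t) * ((∑ i, v i * Real.cos (x i * t)) ^ 2 +
        (∑ i, v i * Real.sin (x i * t)) ^ 2) := by
    simp only [pow_two, Finset.sum_mul_sum, ← Finset.sum_add_distrib]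
    simp only [Finset.mul_sum]
    refine Finset.sum_congr rfl fun i _ => Finset.sum_congr rfl fun j _ => ?_
    rw [sub_mul, Real.cos_sub]
    ring
  simp only [Pi.zero_apply, hsq]
  positivity

theorem posSemidef_of_const {ι : Type*} [Fintype ι] {r : ℝ} (hr : 0 ≤ r) :
    (Matrix.of fun _ _ : ι => r).PosSemidef := by
  refine .of_dotProduct_mulVec_nonneg (by ext; simp) fun v => ?_
  have hsq : star v ⬝ᵥ (Matrix.of fun _ _ : ι => r).mulVec v = r * (∑ i, v i) ^ 2 := by
    simp only [dotProduct, Matrix.mulVec, Matrix.of_apply, star_trivial, pow_two,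
      Finset.sum_mul_sum]
    simp only [Finset.mul_sum]
    exact Finset.sum_congr rfl fun i _ => Finset.sum_congr rfl fun j _ => by ring
  rw [hsq]
  positivity

theorem posSemidef_one_add_sq_div_one_add_sq {ι : Type*} [Fintype ι] {a b : ℝ}
    (h : |a| < |b|) (x : ι → ℝ) :
    (Matrix.of fun i j =>
      (1 + (a * (x i - x j)) ^ 2) / (1 + (b * (x i - x j)) ^ 2)).PosSemidef := by
  have hsq : a ^ 2 < b ^ 2 := sq_lt_sq.mpr h
  have hb : 0 < b ^ 2 := (sq_nonneg a).trans_lt hsq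
  have hr : 0 ≤ 1 - a ^ 2 / b ^ 2 := sub_nonneg.mpr ((div_le_one hb).mpr hsq.le)
  convert (posSemidef_of_const (ι := ι) (div_nonneg (sq_nonneg a) hb.le)).add
    ((posSemidef_one_div_one_add_sq fun i => b * x i).smul hr) using 1
  ext i j
  simp only [Matrix.of_apply, Matrix.add_apply, Matrix.smul_apply, smul_eq_mul, ← mul_sub]
  have hb0 : b ≠ 0 := (pow_ne_zero_iff two_ne_zero).mp hb.ne'
  have hden : 1 + (b * (x i - x j)) ^ 2 ≠ 0 := by positivity
  field_simp
  ring

theorem posSemidef_prod {ι κ : Type*} [Fintype ι] (s : Finset κ) (M : κ → Matrix ι ι ℝ)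
    (hM : ∀ k ∈ s, (M k).PosSemidef) : (Matrix.of fun i j => ∏ k ∈ s, M k i j).PosSemidef := by
  classical
  induction s using Finset.induction_on with
  | empty => simpa using posSemidef_of_const (ι := ι) zero_le_one
  | insert k s hk ih =>
    have hinsert : (Matrix.of fun i j => ∏ l ∈ insert k s, M l i j) =
        (M k).hadamard (Matrix.of fun i j => ∏ l ∈ s, M l i j) := by
      ext i j
      simp [Finset.prod_insert hk]
    rw [hinsert]
    exact (hM k (Finset.mem_insert_self k s)).hadamard
      (ih fun l hl => hM l (Finset.mem_insert_of_mem hl))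

/-- Lemma 2.1(i): `x ↦ cosh(αx)/cosh(βx)` is positive definite when `|β| > |α| > 0`. -/
theorem cosh_quotient_posDef (α β : ℝ) (hα : 0 < |α|) (hαβ : |α| < |β|)
    (n : ℕ) (x : Fin n → ℝ) :
    (Matrix.of fun i j : Fin n =>
      Real.cosh (α * (x i - x j)) / Real.cosh (β * (x i - x j))).PosSemidef := by
  have habs (γ : ℝ) (k : ℕ) : |2 * γ / (Real.pi * (2 * k + 1))| =
      2 / (Real.pi * (2 * k + 1)) * |γ| := by
    have hc : 0 < 2 / (Real.pi * (2 * k + 1)) := div_pos two_pos (by positivity)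
    rw [mul_div_right_comm, abs_mul, abs_of_pos hc]
  have hlim (γ u : ℝ) : Filter.Tendsto
      (fun m : ℕ => ∏ k ∈ Finset.range m, (1 + (2 * γ / (Real.pi * (2 * k + 1)) * u) ^ 2))
      Filter.atTop (nhds (Real.cosh (γ * u))) := by
    have h := Real.tendsto_euler_cosh_prod (γ * u / Real.pi)
    rw [mul_div_cancel₀ _ Real.pi_ne_zero] at h
    refine h.congr fun m => Finset.prod_congr rfl fun k _ => ?_
    have hpi := Real.pi_ne_zero
    field_simp
  refine Matrix.PosSemidef.of_tendsto (fun m => posSemidef_prod (Finset.range m) _ fun k _ =>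
    posSemidef_one_add_sq_div_one_add_sq (a := 2 * α / (Real.pi * (2 * k + 1)))
      (b := 2 * β / (Real.pi * (2 * k + 1))) ?_ x) fun i j => ?_
  · rw [habs, habs]
    exact mul_lt_mul_of_pos_left hαβ (div_pos two_pos (by positivity))
  · simp only [Matrix.of_apply, Finset.prod_div_distrib]
    exact (hlim α _).div (hlim β _) (Real.cosh_pos _).ne'
end

section
/- Let s, t be real numbers with 0 ≤ s < 1/2 and |1 − 2t| < (1 − 2s)/2. Then the Heinz mean H_t strongly dominates the generalized logarithmic mean L_s: for every positive integer n and all positive real numbers λ₁, …, λₙ, the n×n matrix with (i,j) entry H_t(λᵢ, λⱼ)/L_s(λᵢ, λⱼ) is positive semidefinite. (Theorem 2.2(i)) -/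
open scoped Real

/-- The Heinz mean `H_t(a,b) = (a^{1-t} b^t + a^t b^{1-t}) / 2`. -/
noncomputable def heinzMean (t a b : ℝ) : ℝ :=
  (a ^ (1 - t) * b ^ t + a ^ t * b ^ (1 - t)) / 2

/-- The generalized logarithmic mean `L_s(a,b) = (1/(1-2s)) ∫_s^{1-s} a^v b^{1-v} dv`. -/
noncomputable def genLogMean (s a b : ℝ) : ℝ :=
  (1 / (1 - 2 * s)) * ∫ v in s..(1 - s), a ^ v * b ^ (1 - v)

open MeasureTheory Filter Topology Set

namespace Matrix

variable {ι : Type*}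

theorem PosSemidef.of_apply_eq {A B : Matrix ι ι ℝ} (hA : A.PosSemidef)
    (h : ∀ i j, B i j = A i j) : B.PosSemidef :=
  (Matrix.ext h : B = A) ▸ hA

/-- The Schur product theorem, for a real matrix given entrywise as a product. -/
theorem PosSemidef.of_apply_eq_mul {A B C : Matrix ι ι ℝ} (hA : A.PosSemidef)
    (hB : B.PosSemidef) (h : ∀ i j, C i j = A i j * B i j) : C.PosSemidef :=
  (Matrix.ext h : C = A ⊙ B) ▸ hA.hadamard hB

/-- An entrywise limit of positive semidefinite real matrices is positive semidefinite. -/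
theorem posSemidef_of_tendsto {A : ℕ → Matrix ι ι ℝ} {B : Matrix ι ι ℝ}
    (hA : ∀ n, (A n).PosSemidef) (hB : ∀ i j, Tendsto (fun n => A n i j) atTop (𝓝 (B i j))) :
    B.PosSemidef := by
  refine ⟨Matrix.ext fun i j => tendsto_nhds_unique (hB j i) ?_, fun x => ?_⟩
  · exact (hB i j).congr fun n => ((hA n).isHermitian.apply i j).symm
  · refine ge_of_tendsto' (tendsto_finsetSum _ fun i _ => tendsto_finsetSum _ fun j _ =>
      ((hB i j).const_mul _).mul_const _) fun n => (hA n).2 x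

/-- An entrywise integral of positive semidefinite real matrices is positive semidefinite. -/
theorem posSemidef_integral {α : Type*} [MeasurableSpace α] {μ : Measure α}
    {A : α → Matrix ι ι ℝ} (hA : ∀ᵐ a ∂μ, (A a).PosSemidef)
    (hintegrable : ∀ i j, Integrable (fun a => A a i j) μ) :
    (of fun i j => ∫ a, A a i j ∂μ).PosSemidef := by
  refine ⟨Matrix.ext fun i j => integral_congr_ae ?_, fun x => ?_⟩
  · filter_upwards [hA] with a ha using ha.isHermitian.apply i j
  · have key : (x.sum fun i xi => x.sum fun j xj => star xi * (∫ a, A a i j ∂μ) * xj) =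
        ∫ a, (x.sum fun i xi => x.sum fun j xj => star xi * A a i j * xj) ∂μ := by
      simp only [Finsupp.sum]
      have hij : ∀ i j, Integrable (fun a => star (x i) * A a i j * x j) μ := fun i j =>
        ((hintegrable i j).const_mul _).mul_const _
      rw [integral_finsetSum _ fun i _ => integrable_finsetSum _ fun j _ => hij i j]
      refine Finset.sum_congr rfl fun i _ => ?_
      rw [integral_finsetSum _ fun j _ => hij i j]
      refine Finset.sum_congr rfl fun j _ => ?_
      rw [integral_mul_const, integral_const_mul]
    simp only [of_apply]
    rw [key]
    exact integral_nonneg_of_ae (hA.mono fun a ha => ha.2 x)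

theorem posSemidef_of_mul_self (u : ι → ℝ) : (of fun i j => u i * u j).PosSemidef := by
  refine ⟨Matrix.ext fun i j => by simp [mul_comm], fun x => ?_⟩
  have : (x.sum fun i xi => x.sum fun j xj => star xi * (of fun i j => u i * u j) i j * xj) =
      (∑ i ∈ x.support, x i * u i) * ∑ i ∈ x.support, x i * u i := by
    rw [Finset.sum_mul_sum]
    refine Finset.sum_congr rfl fun i _ => Finset.sum_congr rfl fun j _ => ?_
    simp only [star_trivial, of_apply]
    ring
  rw [this]
  exact mul_self_nonneg _

/-- The Cauchy matrix of a positive family is positive semidefinite. -/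
theorem posSemidef_cauchy {a : ι → ℝ} (ha : ∀ i, 0 < a i) :
    (of fun i j => (a i + a j)⁻¹).PosSemidef := by
  have hneg : ∀ i j, -(a i + a j) < 0 := fun i j => neg_neg_of_pos (add_pos (ha i) (ha j))
  have h := posSemidef_integral (μ := volume.restrict (Ioi (0 : ℝ)))
    (A := fun τ => of fun i j => Real.exp (-(a i + a j) * τ))
    (Eventually.of_forall fun τ => by
      refine (posSemidef_of_mul_self fun i => Real.exp (-a i * τ)).of_apply_eq fun i j => ?_
      simp only [of_apply]
      rw [← Real.exp_add]
      ring_nf)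
    (fun i j => integrableOn_exp_mul_Ioi (hneg i j) 0)
  refine h.of_apply_eq fun i j => ?_
  simp only [of_apply]
  rw [integral_exp_mul_Ioi (hneg i j) 0]
  simp [neg_div_neg_eq, -neg_add_rev]

theorem posSemidef_rpow_add_div_add {a : ι → ℝ} (ha : ∀ i, 0 < a i) {r : ℝ} (hr : 0 ≤ r)
    (hr1 : r < 1) : (of fun i j => (a i ^ r + a j ^ r) / (a i + a j)).PosSemidef := by
  rcases hr.eq_or_lt with rfl | hr0
  · refine ((posSemidef_cauchy ha).smul (zero_le_two (α := ℝ))).of_apply_eq fun i j => ?_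
    simp [div_eq_mul_inv, one_add_one_eq_two]
  have hp : r ∈ Ioo (0 : ℝ) 1 := ⟨hr0, hr1⟩
  obtain ⟨μ, hμ⟩ := Real.exists_measure_rpow_eq_integral_rpowIntegrand₀₁ hp
  have hi := fun i => (hμ (a i) (ha i).le).1
  have h := posSemidef_integral (μ := μ.restrict (Ioi (0 : ℝ)))
    (A := fun τ => of fun i j =>
      (Real.rpowIntegrand₀₁ r τ (a i) + Real.rpowIntegrand₀₁ r τ (a j)) / (a i + a j))
    (ae_restrict_of_forall_mem measurableSet_Ioi fun τ hτ => by
      have hτ : 0 < τ := hτ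
      have h1 := (PosSemidef.of_apply_eq_mul
        (C := of fun i j => a i / (τ + a i) * (a j / (τ + a j)) * (a i + a j)⁻¹)
        (posSemidef_of_mul_self fun i => a i / (τ + a i)) (posSemidef_cauchy ha)
        fun _ _ => rfl).smul (mul_nonneg zero_le_two (Real.rpow_nonneg hτ.le (r - 1)))
      have h2 := (posSemidef_of_mul_self fun i => (τ + a i)⁻¹).smul
        (mul_nonneg hτ.le (Real.rpow_nonneg hτ.le (r - 1)))
      refine (h1.add h2).of_apply_eq fun i j => ?_
      have hai := ha i
      have haj := ha j
      simp only [of_apply, add_apply, smul_apply, smul_eq_mul,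
        Real.rpowIntegrand₀₁_eq_pow_div hp hτ.le hai.le,
        Real.rpowIntegrand₀₁_eq_pow_div hp hτ.le haj.le]
      field_simp
      ring)
    (fun i j => ((hi i).add (hi j)).div_const _)
  refine h.of_apply_eq fun i j => ?_
  simp only [of_apply]
  rw [integral_div, integral_add (hi i) (hi j), ← (hμ (a i) (ha i).le).2,
    ← (hμ (a j) (ha j).le).2]

theorem posSemidef_cosh_div_cosh (x : ι → ℝ) {α β : ℝ} (h : |α| < β) :
    (of fun i j => Real.cosh (α * (x i - x j)) / Real.cosh (β * (x i - x j))).PosSemidef := by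
  wlog hα : 0 ≤ α generalizing α
  · have := this (α := -α) (by rwa [abs_neg]) (by linarith)
    simpa only [neg_mul, Real.cosh_neg] using this
  rw [abs_of_nonneg hα] at h
  have hβ : 0 < β := hα.trans_lt h
  have h1 := posSemidef_rpow_add_div_add (a := fun i => Real.exp (2 * β * x i))
    (fun i => Real.exp_pos _) (div_nonneg hα hβ.le) ((div_lt_one hβ).2 h)
  refine h1.of_apply_eq_mul (posSemidef_of_mul_self fun i => Real.exp ((β - α) * x i))
    fun i j => ?_
  have hpow : ∀ y, Real.exp (2 * β * y) ^ (α / β) = Real.exp (2 * α * y) := fun y => by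
    rw [← Real.exp_mul]
    congr 1
    field_simp
  simp only [of_apply, hpow]
  rw [div_mul_eq_mul_div, div_eq_div_iff (Real.cosh_pos _).ne' (by positivity), Real.cosh_eq,
    Real.cosh_eq]
  have e1 : ∀ γ, Real.exp (γ * (x i - x j)) = Real.exp (γ * x i) * (Real.exp (γ * x j))⁻¹ := by
    intro γ
    rw [← Real.exp_neg, ← Real.exp_add]
    ring_nf
  have e2 : ∀ γ y, Real.exp (2 * γ * y) = Real.exp (γ * y) ^ 2 := by
    intro γ y
    rw [← Real.exp_nat_mul]
    push_cast
    ring_nf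
  have e3 : ∀ y, Real.exp ((β - α) * y) = Real.exp (β * y) * (Real.exp (α * y))⁻¹ := by
    intro y
    rw [← Real.exp_neg, ← Real.exp_add]
    ring_nf
  simp only [Real.exp_neg, e1, e2, e3]
  field_simp

end Matrix

namespace Real

theorem dslope_sinh_zero_pos (x : ℝ) : 0 < dslope sinh 0 x := by
  rcases eq_or_ne x 0 with rfl | hx
  · simp
  · rw [dslope_of_ne _ hx, slope_def_field, sinh_zero, sub_zero, sub_zero]
    rcases hx.lt_or_gt with h | h
    · exact div_pos_of_neg_of_neg (sinh_neg_iff.2 h) h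
    · exact div_pos (sinh_pos_iff.2 h) h

theorem dslope_sinh_zero_eq_cosh_mul (x : ℝ) :
    dslope sinh 0 x = cosh (x / 2) * dslope sinh 0 (x / 2) := by
  rcases eq_or_ne x 0 with rfl | hx
  · simp
  · have hx2 : x / 2 ≠ 0 := by simpa using hx
    rw [dslope_of_ne _ hx, dslope_of_ne _ hx2, slope_def_field, slope_def_field, sinh_zero]
    have := sinh_two_mul (x / 2)
    rw [mul_div_cancel₀ x two_ne_zero] at this
    rw [this, sub_zero, sub_zero, sub_zero, sub_zero]
    field_simp

theorem dslope_sinh_zero_eq_prod (x : ℝ) (n : ℕ) :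
    dslope sinh 0 x =
      (∏ k ∈ Finset.range n, cosh ((1 / 2) ^ (k + 1) * x)) * dslope sinh 0 ((1 / 2) ^ n * x) := by
  induction n with
  | zero => simp
  | succ n ih =>
    rw [ih, Finset.prod_range_succ, dslope_sinh_zero_eq_cosh_mul ((1 / 2) ^ n * x)]
    have : (1 / 2 : ℝ) ^ n * x / 2 = (1 / 2) ^ (n + 1) * x := by ring
    rw [this, mul_assoc]

theorem tendsto_prod_inv_cosh (x : ℝ) :
    Tendsto (fun n => ∏ k ∈ Finset.range n, (cosh ((1 / 2) ^ (k + 1) * x))⁻¹) atTop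
      (𝓝 (dslope sinh 0 x)⁻¹) := by
  have h0 : Tendsto (fun n : ℕ => (1 / 2 : ℝ) ^ n * x) atTop (𝓝 0) := by
    simpa using (tendsto_pow_atTop_nhds_zero_of_lt_one (r := (1 / 2 : ℝ)) (by norm_num)
      (by norm_num)).mul_const x
  have hc : Tendsto (dslope sinh 0) (𝓝 0) (𝓝 1) := by
    simpa [ContinuousAt] using continuousAt_dslope_same.2 (differentiable_sinh 0)
  have := (hc.comp h0).mul_const (dslope sinh 0 x)⁻¹
  rw [one_mul] at this
  refine this.congr fun n => ?_
  rw [dslope_sinh_zero_eq_prod x n, Finset.prod_inv_distrib, mul_inv, Function.comp_apply,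
    mul_left_comm, mul_inv_cancel₀ (dslope_sinh_zero_pos _).ne', mul_one]

end Real

theorem Matrix.posSemidef_inv_dslope_sinh {ι : Type*} (x : ι → ℝ) :
    (of fun i j => (dslope Real.sinh 0 (x i - x j))⁻¹).PosSemidef := by
  refine posSemidef_of_tendsto (A := fun n => of fun i j =>
    ∏ k ∈ Finset.range n, (Real.cosh ((1 / 2) ^ (k + 1) * (x i - x j)))⁻¹) (fun n => ?_)
    fun i j => Real.tendsto_prod_inv_cosh _
  induction n with
  | zero => simpa using posSemidef_of_mul_self fun _ : ι => (1 : ℝ)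
  | succ n ih =>
    have h := posSemidef_cosh_div_cosh x (α := 0) (β := (1 / 2) ^ (n + 1)) (by simp)
    refine ih.of_apply_eq_mul h fun i j => ?_
    simp [Finset.prod_range_succ, mul_comm]

theorem heinzMean_exp (t x y : ℝ) :
    heinzMean t (Real.exp x) (Real.exp y) =
      Real.exp ((x + y) / 2) * Real.cosh ((1 - 2 * t) / 2 * (x - y)) := by
  rw [heinzMean, Real.cosh_eq]
  simp only [← Real.exp_mul, ← Real.exp_add]
  rw [mul_div_assoc', mul_add, ← Real.exp_add, ← Real.exp_add]
  ring_nf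

theorem genLogMean_exp {s : ℝ} (hs : s < 1 / 2) (x y : ℝ) :
    genLogMean s (Real.exp x) (Real.exp y) =
      Real.exp ((x + y) / 2) * dslope Real.sinh 0 ((1 - 2 * s) / 2 * (x - y)) := by
  have hc : 1 - 2 * s ≠ 0 := by linarith
  have hexp : ∀ v, Real.exp x ^ v * Real.exp y ^ (1 - v) =
      Real.exp y * Real.exp ((x - y) * v) := fun v => by
    simp only [← Real.exp_mul, ← Real.exp_add]
    ring_nf
  simp only [genLogMean, hexp, intervalIntegral.integral_const_mul]
  rcases eq_or_ne x y with rfl | hxy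
  · simp
    field_simp
    ring
  · have hd : x - y ≠ 0 := sub_ne_zero.2 hxy
    have hcd : (1 - 2 * s) / 2 * (x - y) ≠ 0 := by positivity
    rw [intervalIntegral.integral_comp_mul_left _ hd, integral_exp, dslope_of_ne _ hcd,
      slope_def_field, Real.sinh_zero, Real.sinh_eq, smul_eq_mul]
    have e1 : Real.exp ((x + y) / 2) * Real.exp ((1 - 2 * s) / 2 * (x - y)) =
        Real.exp y * Real.exp ((x - y) * (1 - s)) := by
      simp only [← Real.exp_add]
      ring_nf
    have e2 : Real.exp ((x + y) / 2) * Real.exp (-((1 - 2 * s) / 2 * (x - y))) =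
        Real.exp y * Real.exp ((x - y) * s) := by
      simp only [← Real.exp_add]
      ring_nf
    generalize Real.exp ((x - y) * (1 - s)) = E₁ at *
    generalize Real.exp ((x - y) * s) = E₂ at *
    rw [sub_zero, sub_zero, mul_div_assoc', mul_div_assoc',
      mul_sub (Real.exp ((x + y) / 2)), e1, e2]
    field_simp

/-- Theorem 2.2(i): if `0 ≤ s < 1/2` and `|1 - 2t| < (1 - 2s)/2`, then the Heinz mean `H_t`
strongly dominates the generalized logarithmic mean `L_s`. -/
theorem heinz_strongly_dominates_genLog (s t : ℝ) (hs0 : 0 ≤ s) (hs : s < 1 / 2)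
    (ht : |1 - 2 * t| < (1 - 2 * s) / 2) (n : ℕ) (lam : Fin n → ℝ) (hlam : ∀ i, 0 < lam i) :
    (Matrix.of fun i j : Fin n =>
      heinzMean t (lam i) (lam j) / genLogMean s (lam i) (lam j)).PosSemidef := by
  have h1 := Matrix.posSemidef_inv_dslope_sinh
    (fun i => (1 - 2 * s) / 4 * Real.log (lam i))
  have h2 := Matrix.posSemidef_cosh_div_cosh (fun i => Real.log (lam i))
    (α := (1 - 2 * t) / 2) (β := (1 - 2 * s) / 4) (by
      rw [abs_div, abs_two]
      linarith)
  refine h2.of_apply_eq_mul h1 fun i j => ?_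
  have hH := heinzMean_exp t (Real.log (lam i)) (Real.log (lam j))
  have hL := genLogMean_exp hs (Real.log (lam i)) (Real.log (lam j))
  rw [Real.exp_log (hlam i), Real.exp_log (hlam j)] at hH hL
  simp only [Matrix.of_apply]
  rw [hH, hL, mul_div_mul_left _ _ (Real.exp_pos _).ne', Real.dslope_sinh_zero_eq_cosh_mul,
    ← mul_sub, ← div_eq_mul_inv, div_div]
  ring_nf
end

section
/- Let s be a real number with 0 ≤ s < 1/2. Then the generalized logarithmic mean L_s strongly dominates the Heinz mean H_s: for every positive integer n and all positive real numbers λ₁, …, λₙ, the n×n matrix with (i,j) entry L_s(λᵢ, λⱼ)/H_s(λᵢ, λⱼ) is positive semidefinite. (This is the key matrix positivity claim established in the proof of Theorem 2.4, using the positive definiteness of tanh(x)/x.) -/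
open MeasureTheory

namespace Matrix

variable {ι : Type*}

lemma PosSemidef.apply_comm {K : Matrix ι ι ℝ} (hK : K.PosSemidef) (i j : ι) : K i j = K j i := by
  simpa using hK.isHermitian.apply j i

variable [Fintype ι]

lemma posSemidef_of_symm_of_sum_nonneg {K : Matrix ι ι ℝ} (hsymm : ∀ i j, K i j = K j i)
    (hK : ∀ x : ι → ℝ, 0 ≤ ∑ i, ∑ j, x i * K i j * x j) : K.PosSemidef := by
  refine .of_dotProduct_mulVec_nonneg (IsHermitian.ext fun i j => by simpa using hsymm j i)
    fun x => ?_
  simpa [dotProduct, mulVec, Finset.mul_sum, mul_assoc] using hK x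

lemma PosSemidef.sum_nonneg {K : Matrix ι ι ℝ} (hK : K.PosSemidef) (x : ι → ℝ) :
    0 ≤ ∑ i, ∑ j, x i * K i j * x j := by
  simpa [dotProduct, mulVec, Finset.mul_sum, mul_assoc] using hK.dotProduct_mulVec_nonneg x

lemma PosSemidef.mul_mul_apply {K : Matrix ι ι ℝ} (hK : K.PosSemidef) (d : ι → ℝ) :
    (of fun i j => d i * K i j * d j).PosSemidef := by
  refine posSemidef_of_symm_of_sum_nonneg (fun i j => ?_) fun x => ?_
  · simp only [of_apply, hK.apply_comm i j]
    ring
  · convert hK.sum_nonneg fun i => x i * d i using 1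
    refine Finset.sum_congr rfl fun i _ => Finset.sum_congr rfl fun j _ => ?_
    simp only [of_apply]
    ring

lemma posSemidef_of_mul (d : ι → ℝ) : (of fun i j => d i * d j).PosSemidef := by
  refine posSemidef_of_symm_of_sum_nonneg (fun i j => mul_comm _ _) fun x => ?_
  have h : ∑ i, ∑ j, x i * (d i * d j) * x j = (∑ i, x i * d i) ^ 2 := by
    rw [sq, Finset.sum_mul_sum]
    exact Finset.sum_congr rfl fun i _ => Finset.sum_congr rfl fun j _ => by ring
  simpa only [of_apply, h] using sq_nonneg _

lemma PosSemidef.integral {α : Type*} [MeasurableSpace α] {μ : Measure α} {K : α → Matrix ι ι ℝ}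
    (hint : ∀ i j, Integrable (fun t => K t i j) μ) (hK : ∀ᵐ t ∂μ, (K t).PosSemidef) :
    (of fun i j => ∫ t, K t i j ∂μ).PosSemidef := by
  refine posSemidef_of_symm_of_sum_nonneg (fun i j => ?_) fun x => ?_
  · exact integral_congr_ae (hK.mono fun t ht => ht.apply_comm i j)
  · have hint' (i j : ι) : Integrable (fun t => x i * K t i j * x j) μ :=
      ((hint i j).const_mul _).mul_const _
    have h : ∑ i, ∑ j, x i * (∫ t, K t i j ∂μ) * x j
        = ∫ t, ∑ i, ∑ j, x i * K t i j * x j ∂μ := by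
      rw [integral_finsetSum _ fun i _ => integrable_finsetSum _ fun j _ => hint' i j]
      refine Finset.sum_congr rfl fun i _ => ?_
      rw [integral_finsetSum _ fun j _ => hint' i j]
      refine Finset.sum_congr rfl fun j _ => ?_
      rw [integral_mul_const, integral_const_mul]
    simp only [of_apply, h]
    exact integral_nonneg_of_ae (hK.mono fun t ht => ht.sum_nonneg x)

/-- The symmetric Cauchy matrix `1 / (wᵢ + wⱼ)` is positive semidefinite. -/
lemma posSemidef_of_inv_add {w : ι → ℝ} (hw : ∀ i, 0 < w i) :
    (of fun i j => (w i + w j)⁻¹).PosSemidef := by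
  have hneg (i j : ι) : -(w i + w j) < 0 := by linarith [hw i, hw j]
  have h := PosSemidef.integral (μ := volume.restrict (Set.Ioi (0 : ℝ)))
    (K := fun t => of fun i j => Real.exp (-w i * t) * Real.exp (-w j * t))
    (fun i j => by
      simpa only [of_apply, ← Real.exp_add, ← add_mul, ← neg_add, IntegrableOn] using
        integrableOn_exp_mul_Ioi (hneg i j) 0)
    (.of_forall fun t => posSemidef_of_mul _)
  convert h using 4 with i j
  simp only [of_apply, ← Real.exp_add, ← add_mul]
  rw [← neg_add, integral_exp_mul_Ioi (hneg i j)]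
  rw [mul_zero, Real.exp_zero, neg_div_neg_eq, one_div]

lemma posSemidef_of_rpow_add_rpow_div_add {w : ι → ℝ} (hw : ∀ i, 0 < w i) {p : ℝ} (hp0 : 0 ≤ p)
    (hp1 : p ≤ 1) : (of fun i j => (w i ^ p + w j ^ p) / (w i + w j)).PosSemidef := by
  have hC := posSemidef_of_inv_add hw
  rcases hp0.eq_or_lt with rfl | hp0
  · convert hC.smul (zero_le_two (α := ℝ)) using 1
    ext i j
    simp only [Real.rpow_zero, of_apply, smul_apply, smul_eq_mul]
    ring
  rcases hp1.eq_or_lt with rfl | hp1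
  · convert posSemidef_of_mul (fun _ : ι => (1 : ℝ)) using 1
    ext i j
    simp [div_self (add_pos (hw i) (hw j)).ne']
  obtain ⟨μ, hμ⟩ := Real.exists_measure_rpow_eq_integral_rpowIntegrand₀₁ ⟨hp0, hp1⟩
  have hint (i : ι) := (hμ (w i) (hw i).le).1
  have h := PosSemidef.integral (μ := μ.restrict (Set.Ioi (0 : ℝ)))
    (K := fun t => of fun i j =>
      (Real.rpowIntegrand₀₁ p t (w i) + Real.rpowIntegrand₀₁ p t (w j)) / (w i + w j))
    (fun i j => ((hint i).add (hint j)).div_const _) ?_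
  · convert h using 4 with i j
    simp only [of_apply]
    rw [integral_div, integral_add (hint i) (hint j), ← (hμ _ (hw i).le).2, ← (hμ _ (hw j).le).2]
  filter_upwards [ae_restrict_mem measurableSet_Ioi] with t ht
  have ht : 0 < t := ht
  have hadd := ((hC.mul_mul_apply fun i => w i / (t + w i)).smul (zero_le_two (α := ℝ))).add
    ((posSemidef_of_mul fun i => (t + w i)⁻¹).smul ht.le)
  convert hadd.smul (Real.rpow_nonneg ht.le (p - 1)) using 1
  ext i j
  have hi := hw i
  have hj := hw j
  simp only [of_apply, smul_apply, add_apply, smul_eq_mul,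
    Real.rpowIntegrand₀₁_eq_pow_div ⟨hp0, hp1⟩ ht.le hi.le,
    Real.rpowIntegrand₀₁_eq_pow_div ⟨hp0, hp1⟩ ht.le hj.le]
  field_simp
  ring

end Matrix

lemma heinzMean_one_sub (t a b : ℝ) : heinzMean (1 - t) a b = heinzMean t a b := by
  simp only [heinzMean, sub_sub_cancel]
  ring

lemma continuous_heinzMean {a b : ℝ} (ha : 0 < a) (hb : 0 < b) :
    Continuous fun t => heinzMean t a b := by
  unfold heinzMean
  fun_prop (disch := grind)

lemma genLogMean_eq_integral_heinzMean (s : ℝ) {a b : ℝ} (ha : 0 < a) (hb : 0 < b) :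
    genLogMean s a b = (1 / (1 - 2 * s)) * ∫ v in s..(1 - s), heinzMean v a b := by
  have hc : Continuous fun v : ℝ => a ^ v * b ^ (1 - v) := by fun_prop (disch := grind)
  have hc' : Continuous fun v : ℝ => a ^ (1 - v) * b ^ v := by fun_prop (disch := grind)
  have hsymm : ∫ v in s..(1 - s), a ^ (1 - v) * b ^ v = ∫ v in s..(1 - s), a ^ v * b ^ (1 - v) := by
    simpa using intervalIntegral.integral_comp_sub_left (a := s) (b := 1 - s)
      (fun v : ℝ => a ^ v * b ^ (1 - v)) 1
  simp only [genLogMean, heinzMean]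
  rw [intervalIntegral.integral_div, intervalIntegral.integral_add (hc'.intervalIntegrable _ _)
    (hc.intervalIntegrable _ _), hsymm, add_self_div_two]

lemma heinzMean_div_heinzMean {s t a b : ℝ} (hs : s < 1 / 2) (ha : 0 < a) (hb : 0 < b) :
    heinzMean t a b / heinzMean s a b = a ^ (t - s) *
      (((a ^ (1 - 2 * s)) ^ ((1 - 2 * t) / (1 - 2 * s)) +
        (b ^ (1 - 2 * s)) ^ ((1 - 2 * t) / (1 - 2 * s))) / (a ^ (1 - 2 * s) + b ^ (1 - 2 * s))) *
      b ^ (t - s) := by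
  have h2s : 1 - 2 * s ≠ 0 := by linarith
  have hsplit (r : ℝ) : heinzMean r a b =
      a ^ r * b ^ r * (a ^ (1 - 2 * r) + b ^ (1 - 2 * r)) / 2 := by
    have key (c : ℝ) (hc : 0 < c) : c ^ (1 - r) = c ^ r * c ^ (1 - 2 * r) := by
      rw [← Real.rpow_add hc]
      ring_nf
    rw [heinzMean, key a ha, key b hb]
    ring
  rw [hsplit, hsplit, ← Real.rpow_mul ha.le, ← Real.rpow_mul hb.le, mul_div_cancel₀ _ h2s]
  field_simp
  rw [Real.rpow_sub ha, Real.rpow_sub hb]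
  field_simp

/-- The Heinz mean `H_t` strongly dominates `H_s` when `s ≤ t ≤ 1 - s`. -/
lemma posSemidef_heinzMean_div_heinzMean {ι : Type*} [Fintype ι] {s t : ℝ} (hs : s < 1 / 2)
    (hst : s ≤ t) (hts : t ≤ 1 - s) {lam : ι → ℝ} (hlam : ∀ i, 0 < lam i) :
    (Matrix.of fun i j =>
      heinzMean t (lam i) (lam j) / heinzMean s (lam i) (lam j)).PosSemidef := by
  wlog ht : t ≤ 1 / 2 generalizing t
  · simpa only [heinzMean_one_sub] using
      this (t := 1 - t) (by linarith) (by linarith) (by linarith)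
  have h2s : 0 < 1 - 2 * s := by linarith
  convert (Matrix.posSemidef_of_rpow_add_rpow_div_add
    (fun i => Real.rpow_pos_of_pos (hlam i) (1 - 2 * s)) (p := (1 - 2 * t) / (1 - 2 * s))
    (div_nonneg (by linarith) h2s.le) ((div_le_one h2s).2 (by linarith))).mul_mul_apply
    fun i => lam i ^ (t - s) using 4 with i j
  exact heinzMean_div_heinzMean hs (hlam i) (hlam j)

/-- Key matrix positivity claim from the proof of Theorem 2.4: if `0 ≤ s < 1/2`, then the
generalized logarithmic mean `L_s` strongly dominates the Heinz mean `H_s`. -/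
theorem genLog_strongly_dominates_heinz (s : ℝ) (hs0 : 0 ≤ s) (hs : s < 1 / 2)
    (n : ℕ) (lam : Fin n → ℝ) (hlam : ∀ i, 0 < lam i) :
    (Matrix.of fun i j : Fin n =>
      genLogMean s (lam i) (lam j) / heinzMean s (lam i) (lam j)).PosSemidef := by
  have hle : s ≤ 1 - s := by linarith
  have h := (Matrix.PosSemidef.integral (μ := volume.restrict (Set.Ioc s (1 - s)))
    (K := fun v => Matrix.of fun i j =>
      heinzMean v (lam i) (lam j) / heinzMean s (lam i) (lam j))
    (fun i j => (((continuous_heinzMean (hlam i) (hlam j)).integrableOn_Icc).mono_set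
      Set.Ioc_subset_Icc_self).div_const _)
    (by
      filter_upwards [ae_restrict_mem measurableSet_Ioc] with v hv
      exact posSemidef_heinzMean_div_heinzMean hs hv.1.le hv.2 hlam)).smul
    (one_div_nonneg.2 (by linarith : 0 ≤ 1 - 2 * s))
  convert h using 1
  ext i j
  simp only [Matrix.of_apply, Matrix.smul_apply, smul_eq_mul]
  rw [integral_div, genLogMean_eq_integral_heinzMean s (hlam i) (hlam j),
    intervalIntegral.integral_of_le hle, mul_div_assoc]
end

section
/- Let A and B be n×n positive semidefinite complex matrices, X an arbitrary n×n complex matrix, and let s, t be real numbers with 0 ≤ s < 1/2 and |1 − 2t| < (1 − 2s)/2. Then ‖A^{1−t}XB^t + A^tXB^{1−t}‖ ≤ (2/(1−2s)) ‖∫_s^{1−s} A^v X B^{1−v} dv‖, where ‖·‖ denotes the operator norm induced by the Euclidean norm on ℂⁿ. (Theorem 2.3, instance for the operator norm) -/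
open scoped ComplexOrder

/-- Matrix power of a positive semidefinite matrix via the continuous functional calculus
(equivalently, raising each eigenvalue to the power `v` in a spectral decomposition). -/
noncomputable def mpow {n : ℕ} (A : Matrix (Fin n) (Fin n) ℂ) (v : ℝ) :
    Matrix (Fin n) (Fin n) ℂ :=
  cfc (fun x : ℝ => x ^ v) A

/-- The Frobenius norm of a complex matrix. -/
noncomputable def frobNorm {n : ℕ} (M : Matrix (Fin n) (Fin n) ℂ) : ℝ :=
  Real.sqrt (∑ i, ∑ j, ‖M i j‖ ^ 2)

/-- The operator norm of a complex matrix induced by the Euclidean norm on `ℂⁿ`. -/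
noncomputable def l2OpNorm {n : ℕ} (M : Matrix (Fin n) (Fin n) ℂ) : ℝ :=
  ‖Matrix.toEuclideanCLM (𝕜 := ℂ) M‖

/-- The entrywise integral `∫ A^v X B^{1-v} dv` over `[s, 1-s]`. -/
noncomputable def mInt {n : ℕ} (A B X : Matrix (Fin n) (Fin n) ℂ) (s : ℝ) :
    Matrix (Fin n) (Fin n) ℂ :=
  Matrix.of fun i j => ∫ v in s..(1 - s), (mpow A v * X * mpow B (1 - v)) i j

open Filter Topology

/-- The infinite product expansion of `Real.sinh`. -/
theorem tendsto_sinh_prod (x : ℝ) :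
    Tendsto (fun N : ℕ => x * ∏ j ∈ Finset.range N, (1 + x ^ 2 / (Real.pi ^ 2 * ((j : ℝ) + 1) ^ 2)))
      atTop (𝓝 (Real.sinh x)) := by
  have h := (Complex.continuous_im.tendsto _).comp
    (Complex.tendsto_euler_sin_prod (Complex.I * x / Real.pi))
  have hpi : (Real.pi : ℂ) ≠ 0 := by exact_mod_cast Real.pi_ne_zero
  have e : (Real.pi : ℂ) * (Complex.I * x / Real.pi) = x * Complex.I := by
    field_simp
  rw [e, Complex.sin_mul_I] at h
  have e2 : (Complex.sinh x * Complex.I).im = Real.sinh x := by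
    simp [← Complex.ofReal_sinh]
  rw [e2] at h
  refine h.congr fun N => ?_
  have e3 : ∏ j ∈ Finset.range N,
      ((1 : ℂ) - (Complex.I * x / Real.pi) ^ 2 / ((j : ℂ) + 1) ^ 2) =
      ((∏ j ∈ Finset.range N, (1 + x ^ 2 / (Real.pi ^ 2 * ((j : ℝ) + 1) ^ 2)) : ℝ) : ℂ) := by
    push_cast
    refine Finset.prod_congr rfl fun j _ => ?_
    rw [div_pow, mul_pow, Complex.I_sq]
    field_simp
    ring
  simp only [Function.comp_apply]
  rw [e3, mul_right_comm, ← Complex.ofReal_mul]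
  simp only [Complex.mul_I_im, Complex.ofReal_re]

theorem sinh_prod_two_mul (x : ℝ) (N : ℕ) :
    ∏ j ∈ Finset.range (2 * N), (1 + (2 * x) ^ 2 / (Real.pi ^ 2 * ((j : ℝ) + 1) ^ 2)) =
      (∏ j ∈ Finset.range N, (1 + 4 * x ^ 2 / (Real.pi ^ 2 * (2 * (j : ℝ) + 1) ^ 2))) *
        ∏ j ∈ Finset.range N, (1 + x ^ 2 / (Real.pi ^ 2 * ((j : ℝ) + 1) ^ 2)) := by
  induction N with
  | zero => simp
  | succ N ih =>
    rw [show 2 * (N + 1) = 2 * N + 1 + 1 by ring, Finset.prod_range_succ, Finset.prod_range_succ,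
      ih, Finset.prod_range_succ, Finset.prod_range_succ]
    have h1 : (2 * x) ^ 2 / (Real.pi ^ 2 * (((2 * N : ℕ) : ℝ) + 1) ^ 2) =
        4 * x ^ 2 / (Real.pi ^ 2 * (2 * (N : ℝ) + 1) ^ 2) := by
      push_cast; ring
    have h2 : (2 * x) ^ 2 / (Real.pi ^ 2 * (((2 * N + 1 : ℕ) : ℝ) + 1) ^ 2) =
        x ^ 2 / (Real.pi ^ 2 * ((N : ℝ) + 1) ^ 2) := by
      have : (N : ℝ) + 1 ≠ 0 := by positivity
      have : (2 * N : ℝ) + 1 + 1 ≠ 0 := by positivity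
      push_cast
      field_simp
      ring
    rw [h1, h2]
    ring

/-- The infinite product expansion of `Real.cosh`. -/
theorem tendsto_cosh_prod (x : ℝ) :
    Tendsto (fun N : ℕ => ∏ j ∈ Finset.range N,
        (1 + 4 * x ^ 2 / (Real.pi ^ 2 * (2 * (j : ℝ) + 1) ^ 2)))
      atTop (𝓝 (Real.cosh x)) := by
  rcases eq_or_ne x 0 with rfl | hx
  · simp
  have hs : Real.sinh x ≠ 0 := by simpa using hx
  have h2 : Tendsto (fun N : ℕ => 2 * N) atTop atTop :=
    tendsto_id.const_mul_atTop' (by norm_num)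
  have h := ((tendsto_sinh_prod (2 * x)).comp h2).div ((tendsto_sinh_prod x).const_mul 2)
    (by simpa using hx)
  have e : Real.sinh (2 * x) / (2 * Real.sinh x) = Real.cosh x := by
    rw [Real.sinh_two_mul]; field_simp
  rw [e] at h
  refine h.congr fun N => ?_
  have hP : ∏ j ∈ Finset.range N, (1 + x ^ 2 / (Real.pi ^ 2 * ((j : ℝ) + 1) ^ 2)) ≠ 0 :=
    Finset.prod_ne_zero_iff.2 fun j _ => by positivity
  simp only [Function.comp_apply, Pi.div_apply]
  rw [sinh_prod_two_mul]
  field_simp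

/-- The kernel `u cosh (α u) / sinh u`, extended by its limit `1` at the origin. -/
noncomputable def coshDivSinhc (α u : ℝ) : ℝ :=
  if u = 0 then 1 else u * Real.cosh (α * u) / Real.sinh u

theorem tendsto_coshDivSinhc (α u : ℝ) :
    Tendsto (fun N : ℕ => ∏ j ∈ Finset.range N,
        ((1 + 4 * α ^ 2 / (Real.pi ^ 2 * (2 * (j : ℝ) + 1) ^ 2) * u ^ 2) /
          (1 + 1 / (Real.pi ^ 2 * ((j : ℝ) + 1) ^ 2) * u ^ 2)))
      atTop (𝓝 (coshDivSinhc α u)) := by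
  rcases eq_or_ne u 0 with rfl | hu
  · simp [coshDivSinhc]
  have hs : Real.sinh u ≠ 0 := by simpa using hu
  have h := ((tendsto_cosh_prod (α * u)).const_mul u).div (tendsto_sinh_prod u) hs
  rw [coshDivSinhc, if_neg hu]
  refine h.congr fun N => ?_
  rw [Finset.prod_div_distrib]
  simp only [Pi.div_apply]
  rw [mul_div_mul_left _ _ hu]
  congr 1 <;> refine Finset.prod_congr rfl fun j _ => by ring

/-- For self-adjoint `H` and `K`, adding the skew part `i c (H Z - Z K)` to `Z` does not decrease
the norm. -/
theorem norm_le_norm_add_I_smul_commutator {E : Type*} [NormedAddCommGroup E]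
    [InnerProductSpace ℂ E] [FiniteDimensional ℂ E] (Z H K : E →L[ℂ] E)
    (hH : IsSelfAdjoint H) (hK : IsSelfAdjoint K) (c : ℝ) :
    ‖Z‖ ≤ ‖Z + (Complex.I * c) • (H * Z - Z * K)‖ := by
  have : CompleteSpace E := FiniteDimensional.complete ℂ E
  have : ProperSpace E := FiniteDimensional.proper ℂ E
  rcases eq_or_ne Z 0 with rfl | hZ
  · simp
  have hpos : 0 < ‖Z‖ := norm_pos_iff.2 hZ
  obtain ⟨u, hu1, humax⟩ := (isCompact_closedBall (0 : E) 1).exists_isMaxOn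
    (Metric.nonempty_closedBall.2 zero_le_one) (f := fun x => ‖Z x‖) (by fun_prop)
  have hu1 : ‖u‖ ≤ 1 := by simpa using hu1
  have hZu : ‖Z u‖ = ‖Z‖ := by
    refine le_antisymm ?_ ?_
    · exact (Z.le_opNorm u).trans (mul_le_of_le_one_right hpos.le hu1)
    · refine ContinuousLinearMap.opNorm_le_of_unit_norm (norm_nonneg _) fun x hx => ?_
      exact humax (by simp [hx])
  have hadj : Z.adjoint (Z u) = ((‖Z‖ ^ 2 : ℝ) : ℂ) • u := by
    rw [← sub_eq_zero, ← norm_eq_zero, ← sq_eq_zero_iff]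
    refine le_antisymm ?_ (sq_nonneg _)
    rw [@norm_sub_sq ℂ, inner_smul_right, ContinuousLinearMap.adjoint_inner_left,
      inner_self_eq_norm_sq_to_K, norm_smul, hZu]
    have h1 : ‖Z.adjoint (Z u)‖ ≤ ‖Z‖ ^ 2 := by
      refine (Z.adjoint.le_opNorm _).trans ?_
      rw [hZu, LinearIsometryEquiv.norm_map, sq]
    have h2 : ‖Z.adjoint (Z u)‖ ^ 2 ≤ (‖Z‖ ^ 2) ^ 2 := by gcongr
    have h3 : ‖u‖ ^ 2 ≤ 1 := by nlinarith [norm_nonneg u]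
    have h4 : RCLike.re (((‖Z‖ ^ 2 : ℝ) : ℂ) * ((‖Z‖ : ℝ) : ℂ) ^ 2) = (‖Z‖ ^ 2) ^ 2 := by
      rw [← Complex.ofReal_pow, ← Complex.ofReal_mul]
      simp [sq]
    have h5 : ‖((‖Z‖ ^ 2 : ℝ) : ℂ)‖ = ‖Z‖ ^ 2 := by
      rw [Complex.norm_real, Real.norm_of_nonneg (by positivity)]
    erw [h4]
    rw [h5]
    nlinarith [mul_le_mul_of_nonneg_left h3 (sq_nonneg (‖Z‖ ^ 2))]
  have hre : ∀ T : E →L[ℂ] E, IsSelfAdjoint T → ∀ x, (inner ℂ x (T x)).im = 0 := fun T hT x =>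
    hT.isSymmetric.im_inner_self_apply x
  have hin : (inner ℂ (Z u) ((Z + (Complex.I * c) • (H * Z - Z * K)) u)).re = ‖Z‖ ^ 2 := by
    have hK' : inner ℂ (Z u) (Z (K u)) = ((‖Z‖ ^ 2 : ℝ) : ℂ) * inner ℂ u (K u) := by
      rw [← ContinuousLinearMap.adjoint_inner_left, hadj, inner_smul_left, Complex.conj_ofReal]
    simp only [add_apply, smul_apply, sub_apply, mul_apply_eq_comp,
      inner_add_right, inner_smul_right, inner_sub_right, hK']
    rw [inner_self_eq_norm_sq_to_K, hZu]
    have h1 := hre H hH (Z u)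
    have h2 := hre K hK u
    simp [Complex.mul_re, h1, h2, ← Complex.ofReal_pow]
  have hle : ‖Z‖ ^ 2 ≤ ‖Z‖ * ‖Z + (Complex.I * c) • (H * Z - Z * K)‖ := by
    rw [← hin]
    refine (Complex.re_le_norm _).trans ((norm_inner_le_norm _ _).trans ?_)
    rw [hZu]
    gcongr
    exact (ContinuousLinearMap.le_opNorm _ _).trans (mul_le_of_le_one_right (norm_nonneg _) hu1)
  nlinarith

/-- `f` acts contractively, in operator norm, as the Schur multiplier with symbol
`f (x i - y j)`. -/
def IsSchurContraction (f : ℝ → ℝ) : Prop :=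
  ∀ (n : ℕ) (x y : Fin n → ℝ) (M : Matrix (Fin n) (Fin n) ℂ),
    l2OpNorm (Matrix.of fun i j => (f (x i - y j) : ℂ) * M i j) ≤ l2OpNorm M

theorem l2OpNorm_le_of_one_add_I_mul {n : ℕ} (x y : Fin n → ℝ) (c : ℝ)
    (Z : Matrix (Fin n) (Fin n) ℂ) :
    l2OpNorm Z ≤
      l2OpNorm (Matrix.of fun i j => (1 + Complex.I * c * ((x i - y j : ℝ) : ℂ)) * Z i j) := by
  have hsa : ∀ w : Fin n → ℝ, IsSelfAdjoint
      (Matrix.toEuclideanCLM (𝕜 := ℂ) (Matrix.diagonal fun i => (w i : ℂ))) := fun w => by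
    refine IsSelfAdjoint.map ?_ _
    ext i j
    by_cases h : i = j
    · subst h; simp
    · simp [Matrix.diagonal_apply_ne _ h, Matrix.diagonal_apply_ne _ (Ne.symm h)]
  refine (norm_le_norm_add_I_smul_commutator _ _ _ (hsa x) (hsa y) c).trans_eq ?_
  rw [l2OpNorm, ← map_mul, ← map_mul, ← map_sub, ← map_smul, ← map_add]
  congr 2
  ext i j
  simp only [Matrix.add_apply, Matrix.smul_apply, Matrix.sub_apply, Matrix.diagonal_mul,
    Matrix.mul_diagonal, Matrix.of_apply, smul_eq_mul]
  push_cast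
  ring

namespace IsSchurContraction

theorem one : IsSchurContraction fun _ => 1 := fun n x y M => by
  simp only [Complex.ofReal_one, one_mul]
  exact le_rfl

theorem mul {f g : ℝ → ℝ} (hf : IsSchurContraction f) (hg : IsSchurContraction g) :
    IsSchurContraction fun u => f u * g u := fun n x y M => by
  refine le_trans (le_of_eq ?_) ((hf n x y _).trans (hg n x y M))
  congr 1
  ext i j
  simp [mul_assoc]

theorem prod {ι : Type*} {f : ι → ℝ → ℝ} (s : Finset ι) (hf : ∀ j, IsSchurContraction (f j)) :
    IsSchurContraction fun u => ∏ j ∈ s, f j u := by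
  classical
  induction s using Finset.induction_on with
  | empty => simpa using one
  | insert a s ha ih => simpa [Finset.prod_insert ha] using (hf a).mul ih

theorem convex_comb {f g : ℝ → ℝ} (hf : IsSchurContraction f) (hg : IsSchurContraction g)
    {a b : ℝ} (ha : 0 ≤ a) (hb : 0 ≤ b) (hab : a + b = 1) :
    IsSchurContraction fun u => a * f u + b * g u := fun n x y M => by
  have e : (Matrix.of fun i j => ((a * f (x i - y j) + b * g (x i - y j) : ℝ) : ℂ) * M i j) =
      (a : ℂ) • (Matrix.of fun i j => (f (x i - y j) : ℂ) * M i j) +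
      (b : ℂ) • (Matrix.of fun i j => (g (x i - y j) : ℂ) * M i j) := by
    ext i j
    simp only [Matrix.add_apply, Matrix.smul_apply, Matrix.of_apply, smul_eq_mul]
    push_cast
    ring
  have h1 := hf n x y M
  have h2 := hg n x y M
  unfold l2OpNorm at *
  rw [e, map_add, map_smul, map_smul]
  refine (norm_add_le _ _).trans ?_
  rw [norm_smul, norm_smul, Complex.norm_real, Complex.norm_real, Real.norm_of_nonneg ha,
    Real.norm_of_nonneg hb]
  refine (add_le_add (mul_le_mul_of_nonneg_left h1 ha)
    (mul_le_mul_of_nonneg_left h2 hb)).trans_eq ?_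
  rw [← add_mul, hab, one_mul]

theorem of_tendsto {f : ℕ → ℝ → ℝ} {g : ℝ → ℝ} (hf : ∀ N, IsSchurContraction (f N))
    (h : ∀ u, Tendsto (fun N => f N u) atTop (𝓝 (g u))) : IsSchurContraction g :=
  fun n x y M => by
    have hc : Continuous fun Z : Matrix (Fin n) (Fin n) ℂ => l2OpNorm Z :=
      (LinearMap.continuous_of_finiteDimensional
        (Matrix.toEuclideanCLM (n := Fin n) (𝕜 := ℂ)).toAlgEquiv.toLinearMap).norm
    have ht : Tendsto
        (fun N => (Matrix.of fun i j => (f N (x i - y j) : ℂ) * M i j : Matrix (Fin n) (Fin n) ℂ))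
        atTop (𝓝 (Matrix.of fun i j => (g (x i - y j) : ℂ) * M i j)) := by
      refine tendsto_pi_nhds.2 fun i => tendsto_pi_nhds.2 fun j => ?_
      exact ((Complex.continuous_ofReal.tendsto _).comp (h (x i - y j))).mul_const (M i j)
    exact le_of_tendsto ((hc.tendsto _).comp ht) (Eventually.of_forall fun N => hf N n x y M)

theorem resolvent {b : ℝ} (hb : 0 ≤ b) : IsSchurContraction fun u => 1 / (1 + b * u ^ 2) :=
  fun n x y M => by
    refine (l2OpNorm_le_of_one_add_I_mul x y (Real.sqrt b) _).trans
      ((l2OpNorm_le_of_one_add_I_mul x y (-Real.sqrt b) _).trans_eq ?_)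
    congr 1
    ext i j
    simp only [Matrix.of_apply]
    set u : ℝ := x i - y j
    have h0 : (1 + b * u ^ 2 : ℝ) ≠ 0 := by positivity
    have h0' : (1 + b * u ^ 2 : ℂ) ≠ 0 := by exact_mod_cast h0
    have hs : ((Real.sqrt b : ℝ) : ℂ) ^ 2 = b := by
      rw [← Complex.ofReal_pow, Real.sq_sqrt hb]
    have e : (1 + Complex.I * ((-Real.sqrt b : ℝ) : ℂ) * u) * (1 + Complex.I * (Real.sqrt b : ℝ) * u)
        = 1 + b * (u : ℂ) ^ 2 := by
      rw [← hs]
      push_cast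
      linear_combination (-(Real.sqrt b : ℂ) ^ 2 * (u : ℂ) ^ 2) * Complex.I_sq
    rw [← mul_assoc, ← mul_assoc, e]
    push_cast
    field_simp

theorem one_add_div_one_add {a b : ℝ} (ha : 0 ≤ a) (hab : a ≤ b) :
    IsSchurContraction fun u => (1 + a * u ^ 2) / (1 + b * u ^ 2) := by
  rcases (ha.trans hab).eq_or_lt with hb | hb
  · subst hb
    obtain rfl := le_antisymm hab ha
    simpa using one
  · convert one.convex_comb (resolvent hb.le) (a := a / b) (b := 1 - a / b) (by positivity)
      (sub_nonneg.2 ((div_le_one hb).2 hab)) (by ring) using 2 with u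
    have : 1 + b * u ^ 2 ≠ 0 := by positivity
    field_simp
    ring

theorem coshDivSinhc {α : ℝ} (hα : 4 * α ^ 2 ≤ 1) : IsSchurContraction (coshDivSinhc α) := by
  refine of_tendsto (fun N => prod _ fun j => ?_) (tendsto_coshDivSinhc α)
  refine one_add_div_one_add (by positivity) ?_
  have hj : (0 : ℝ) ≤ j := j.cast_nonneg
  gcongr
  linarith

end IsSchurContraction

/-- The Heinz weight of two nonnegative eigenvalues is `coshDivSinhc` times their normalised
logarithmic weight. -/
theorem heinz_weight_eq {a b s t : ℝ} (ha : 0 ≤ a) (hb : 0 ≤ b) (hs0 : 0 ≤ s) (hs : s < 1 / 2)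
    (ht : |1 - 2 * t| < (1 - 2 * s) / 2) :
    a ^ (1 - t) * b ^ t + a ^ t * b ^ (1 - t) =
      coshDivSinhc ((1 - 2 * t) / (1 - 2 * s))
        ((1 - 2 * s) / 2 * Real.log a - (1 - 2 * s) / 2 * Real.log b) *
      (2 / (1 - 2 * s) * ∫ v in s..(1 - s), a ^ v * b ^ (1 - v)) := by
  obtain ⟨ht1, ht2⟩ := abs_lt.1 ht
  have hle : s ≤ 1 - s := by linarith
  have h0 : a = 0 ∨ b = 0 → ∫ v in s..(1 - s), a ^ v * b ^ (1 - v) = 0 := by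
    intro h
    rw [intervalIntegral.integral_of_le hle, MeasureTheory.integral_Ioc_eq_integral_Ioo]
    refine MeasureTheory.setIntegral_eq_zero_of_forall_eq_zero fun v hv => ?_
    rcases h with rfl | rfl
    · rw [Real.zero_rpow (by linarith [hv.1]), zero_mul]
    · rw [Real.zero_rpow (by linarith [hv.2]), mul_zero]
  rcases ha.eq_or_lt with rfl | ha
  · rw [h0 (.inl rfl), Real.zero_rpow (by linarith), Real.zero_rpow (by linarith)]
    simp
  rcases hb.eq_or_lt with rfl | hb
  · rw [h0 (.inr rfl), Real.zero_rpow (by linarith), Real.zero_rpow (by linarith)]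
    simp
  obtain ⟨p, rfl⟩ : ∃ p, a = Real.exp p := ⟨Real.log a, (Real.exp_log ha).symm⟩
  obtain ⟨q, rfl⟩ : ∃ q, b = Real.exp q := ⟨Real.log b, (Real.exp_log hb).symm⟩
  simp only [Real.log_exp, ← Real.exp_mul, ← Real.exp_add]
  have hβ : 0 < 1 - 2 * s := by linarith
  rcases eq_or_ne p q with rfl | hpq
  · have e : ∀ v : ℝ, p * v + p * (1 - v) = p := fun v => by ring
    simp only [e, sub_self, coshDivSinhc, if_true]
    rw [show p * (1 - t) + p * t = p by ring, intervalIntegral.integral_const, smul_eq_mul]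
    field_simp
    ring
  have hr : p - q ≠ 0 := sub_ne_zero.2 hpq
  have hint : ∫ v in s..(1 - s), Real.exp (p * v + q * (1 - v)) =
      (Real.exp (p * (1 - s) + q * s) - Real.exp (p * s + q * (1 - s))) / (p - q) := by
    rw [intervalIntegral.integral_eq_sub_of_hasDerivAt
      (f := fun v => Real.exp (p * v + q * (1 - v)) / (p - q))]
    · rw [show 1 - (1 - s) = s by ring]; ring
    · intro v _
      have h : HasDerivAt (fun v : ℝ => p * v + q * (1 - v)) (p * 1 + q * (-1)) v :=
        ((hasDerivAt_id v).const_mul p).add (((hasDerivAt_id v).const_sub 1).const_mul q)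
      have h' := h.exp.div_const (p - q)
      rwa [mul_one, mul_neg_one, ← sub_eq_add_neg, mul_div_cancel_right₀ _ hr] at h'
    · exact (by fun_prop : Continuous fun v : ℝ =>
        Real.exp (p * v + q * (1 - v))).intervalIntegrable _ _
  rw [hint]
  set u := (1 - 2 * s) / 2 * p - (1 - 2 * s) / 2 * q with hu
  have hu0 : u ≠ 0 := by
    rw [hu, ← mul_sub]; positivity
  have hsu : Real.sinh u ≠ 0 := by simpa using hu0
  have e1 : Real.exp (p * (1 - s) + q * s) - Real.exp (p * s + q * (1 - s)) =
      Real.exp ((p + q) / 2) * (2 * Real.sinh u) := by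
    rw [Real.sinh_eq, show p * (1 - s) + q * s = (p + q) / 2 + u by rw [hu]; ring,
      show p * s + q * (1 - s) = (p + q) / 2 + -u by rw [hu]; ring, Real.exp_add, Real.exp_add]
    ring
  have e2 : Real.exp (p * (1 - t) + q * t) + Real.exp (p * t + q * (1 - t)) =
      Real.exp ((p + q) / 2) * (2 * Real.cosh ((1 - 2 * t) / (1 - 2 * s) * u)) := by
    have e3 : (1 - 2 * t) / (1 - 2 * s) * u = (1 - 2 * t) / 2 * (p - q) := by
      rw [hu]; field_simp
    rw [e3, Real.cosh_eq, show p * (1 - t) + q * t = (p + q) / 2 + (1 - 2 * t) / 2 * (p - q) by ring,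
      show p * t + q * (1 - t) = (p + q) / 2 + -((1 - 2 * t) / 2 * (p - q)) by ring,
      Real.exp_add, Real.exp_add]
    ring
  have e4 : p - q = 2 * u / (1 - 2 * s) := by
    rw [hu]; field_simp
  rw [e1, e2, e4, coshDivSinhc, if_neg hu0]
  field_simp

theorem intervalIntegrable_rpow_mul_rpow {a b s : ℝ} (ha : 0 ≤ a) (hb : 0 ≤ b) (hs0 : 0 ≤ s)
    (hs : s < 1 / 2) :
    IntervalIntegrable (fun v => a ^ v * b ^ (1 - v)) MeasureTheory.volume s (1 - s) := by
  have hle : s ≤ 1 - s := by linarith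
  by_cases h : a = 0 ∨ b = 0
  · rw [intervalIntegrable_iff_integrableOn_Ioo_of_le hle]
    refine MeasureTheory.integrableOn_zero.congr_fun (fun v hv => ?_) measurableSet_Ioo
    rcases h with rfl | rfl
    · simp [Real.zero_rpow (show v ≠ 0 by linarith [hv.1])]
    · simp [Real.zero_rpow (show 1 - v ≠ 0 by linarith [hv.2])]
  · push Not at h
    have h1 : Continuous fun v : ℝ => a ^ v := Real.continuous_const_rpow h.1
    have h2 : Continuous fun v : ℝ => b ^ v := Real.continuous_const_rpow h.2
    exact (h1.mul (h2.comp (continuous_const.sub continuous_id))).intervalIntegrable _ _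

theorem mpow_eq_conj {n : ℕ} {A : Matrix (Fin n) (Fin n) ℂ} (hA : A.IsHermitian) (v : ℝ) :
    mpow A v = (hA.eigenvectorUnitary : Matrix (Fin n) (Fin n) ℂ) *
      Matrix.diagonal (fun i => ((hA.eigenvalues i ^ v : ℝ) : ℂ)) *
      star (hA.eigenvectorUnitary : Matrix (Fin n) (Fin n) ℂ) := by
  rw [mpow, hA.cfc_eq, Matrix.IsHermitian.cfc, Unitary.conjStarAlgAut_apply]
  rfl

theorem mpow_mul_mul_mpow {n : ℕ} {A B : Matrix (Fin n) (Fin n) ℂ} (hA : A.IsHermitian)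
    (hB : B.IsHermitian) (X : Matrix (Fin n) (Fin n) ℂ) (v w : ℝ) :
    mpow A v * X * mpow B w = (hA.eigenvectorUnitary : Matrix (Fin n) (Fin n) ℂ) *
      (Matrix.of fun i j => ((hA.eigenvalues i ^ v * hB.eigenvalues j ^ w : ℝ) : ℂ) *
        (star (hA.eigenvectorUnitary : Matrix (Fin n) (Fin n) ℂ) * X *
          (hB.eigenvectorUnitary : Matrix (Fin n) (Fin n) ℂ)) i j) *
      star (hB.eigenvectorUnitary : Matrix (Fin n) (Fin n) ℂ) := by
  rw [mpow_eq_conj hA, mpow_eq_conj hB]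
  set U := (hA.eigenvectorUnitary : Matrix (Fin n) (Fin n) ℂ)
  set V := (hB.eigenvectorUnitary : Matrix (Fin n) (Fin n) ℂ)
  have e : (Matrix.of fun i j => ((hA.eigenvalues i ^ v * hB.eigenvalues j ^ w : ℝ) : ℂ) *
        (star U * X * V) i j) =
      Matrix.diagonal (fun i => ((hA.eigenvalues i ^ v : ℝ) : ℂ)) * (star U * X * V) *
        Matrix.diagonal (fun i => ((hB.eigenvalues i ^ w : ℝ) : ℂ)) := by
    ext i j
    simp only [Matrix.diagonal_mul, Matrix.mul_diagonal, Matrix.of_apply]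
    push_cast
    ring
  rw [e]
  simp only [mul_assoc]

theorem mInt_eq_conj {n : ℕ} {A B : Matrix (Fin n) (Fin n) ℂ} (hA : A.PosSemidef)
    (hB : B.PosSemidef) (X : Matrix (Fin n) (Fin n) ℂ) {s : ℝ} (hs0 : 0 ≤ s) (hs : s < 1 / 2) :
    mInt A B X s = (hA.isHermitian.eigenvectorUnitary : Matrix (Fin n) (Fin n) ℂ) *
      (Matrix.of fun i j => ((∫ v in s..(1 - s),
          hA.isHermitian.eigenvalues i ^ v * hB.isHermitian.eigenvalues j ^ (1 - v) : ℝ) : ℂ) *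
        (star (hA.isHermitian.eigenvectorUnitary : Matrix (Fin n) (Fin n) ℂ) * X *
          (hB.isHermitian.eigenvectorUnitary : Matrix (Fin n) (Fin n) ℂ)) i j) *
      star (hB.isHermitian.eigenvectorUnitary : Matrix (Fin n) (Fin n) ℂ) := by
  ext i j
  simp only [mInt, Matrix.of_apply, mpow_mul_mul_mpow hA.isHermitian hB.isHermitian]
  set Y := star (hA.isHermitian.eigenvectorUnitary : Matrix (Fin n) (Fin n) ℂ) * X *
          (hB.isHermitian.eigenvectorUnitary : Matrix (Fin n) (Fin n) ℂ)
  have hint : ∀ k l, IntervalIntegrable (fun v => ((hA.isHermitian.eigenvalues k ^ v *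
      hB.isHermitian.eigenvalues l ^ (1 - v) : ℝ) : ℂ)) MeasureTheory.volume s (1 - s) :=
    fun k l =>
      have h := intervalIntegrable_rpow_mul_rpow (hA.eigenvalues_nonneg k)
        (hB.eigenvalues_nonneg l) hs0 hs
      ⟨h.1.ofReal, h.2.ofReal⟩
  simp only [Matrix.mul_apply (M := _ * _), Matrix.mul_apply (N := Matrix.of _), Matrix.of_apply]
  rw [intervalIntegral.integral_finsetSum fun l _ => ?_]
  · refine Finset.sum_congr rfl fun l _ => ?_
    rw [intervalIntegral.integral_mul_const, intervalIntegral.integral_finsetSum fun k _ => ?_]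
    · congr 1
      refine Finset.sum_congr rfl fun k _ => ?_
      rw [intervalIntegral.integral_const_mul, intervalIntegral.integral_mul_const,
        intervalIntegral.integral_ofReal]
    · exact ((hint k l).mul_const _).const_mul _
  · refine IntervalIntegrable.mul_const ?_ _
    rw [← Finset.sum_fn]
    refine IntervalIntegrable.sum _ fun k _ => ?_
    exact ((hint k l).mul_const _).const_mul _

theorem l2OpNorm_unitary_mul_mul_star {n : ℕ} (U V : unitary (Matrix (Fin n) (Fin n) ℂ))
    (M : Matrix (Fin n) (Fin n) ℂ) :
    l2OpNorm ((U : Matrix (Fin n) (Fin n) ℂ) * M * star (V : Matrix (Fin n) (Fin n) ℂ)) =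
      l2OpNorm M := by
  open scoped Matrix.Norms.L2Operator in
  change ‖(U : Matrix (Fin n) (Fin n) ℂ) * M * ((star V : unitary _) : Matrix (Fin n) (Fin n) ℂ)‖ =
    ‖M‖
  rw [CStarRing.norm_mul_coe_unitary, CStarRing.norm_coe_unitary_mul]

/-- Theorem 2.3 for the operator norm. -/
theorem heinz_le_genLog_opNorm (n : ℕ) (A B X : Matrix (Fin n) (Fin n) ℂ)
    (hA : A.PosSemidef) (hB : B.PosSemidef) (s t : ℝ) (hs0 : 0 ≤ s) (hs : s < 1 / 2)
    (ht : |1 - 2 * t| < (1 - 2 * s) / 2) :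
    l2OpNorm (mpow A (1 - t) * X * mpow B t + mpow A t * X * mpow B (1 - t)) ≤
      (2 / (1 - 2 * s)) * l2OpNorm (mInt A B X s) := by
  have hβ : 0 < 1 - 2 * s := by linarith
  have hα : 4 * ((1 - 2 * t) / (1 - 2 * s)) ^ 2 ≤ 1 := by
    rw [div_pow, ← mul_div_assoc, div_le_one (by positivity)]
    obtain ⟨h1, h2⟩ := abs_lt.1 ht
    nlinarith
  rw [mpow_mul_mul_mpow hA.isHermitian hB.isHermitian, mpow_mul_mul_mpow hA.isHermitian
    hB.isHermitian, mInt_eq_conj hA hB X hs0 hs, ← add_mul, ← mul_add,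
    l2OpNorm_unitary_mul_mul_star, l2OpNorm_unitary_mul_mul_star]
  set Y := star (hA.isHermitian.eigenvectorUnitary : Matrix (Fin n) (Fin n) ℂ) * X *
    (hB.isHermitian.eigenvectorUnitary : Matrix (Fin n) (Fin n) ℂ)
  have hsmul : ∀ M : Matrix (Fin n) (Fin n) ℂ,
      2 / (1 - 2 * s) * l2OpNorm M = l2OpNorm (((2 / (1 - 2 * s) : ℝ) : ℂ) • M) := fun M => by
    rw [l2OpNorm, l2OpNorm, map_smul, norm_smul, Complex.norm_real,
      Real.norm_of_nonneg (by positivity)]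
  rw [hsmul]
  refine le_trans (le_of_eq ?_) (IsSchurContraction.coshDivSinhc hα n
    (fun i => (1 - 2 * s) / 2 * Real.log (hA.isHermitian.eigenvalues i))
    (fun j => (1 - 2 * s) / 2 * Real.log (hB.isHermitian.eigenvalues j)) _)
  congr 1
  ext i j
  simp only [Matrix.add_apply, Matrix.of_apply, Matrix.smul_apply, smul_eq_mul]
  rw [← add_mul, ← Complex.ofReal_add, heinz_weight_eq (hA.eigenvalues_nonneg i)
    (hB.eigenvalues_nonneg j) hs0 hs ht]
  push_cast
  ring
end
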